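/- Let 𝙰, 𝙱 be admissible arrays which are compositions of (Σ_1, w_1) and (Σ_2, w_2) respectively, where Σ_1, Σ_2 are finite weighted subsets of ℕ* and w_1, w_2 are positive integers. Then there exist finitely many elements α'_1,…,α'_m ∈ F_q and admissible arrays 𝙲'_1,…,𝙲'_m, each a composition of (Σ_1 ⊔ Σ_2, w_1 + w_2), all independent of d, such that for all d ∈ ℕ: S_{<d}(𝙰) · S_{<d}(𝙱) = Σ_{i=1}^{m} α'_i S_{<d}(𝙲'_i). -/

import Mathlib

/-!
STATEMENT 6: Let `𝙰, 𝙱` be admissible arrays which are compositions of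
`(Σ₁, w₁)` and `(Σ₂, w₂)` respectively.  Then there exist finitely many
`α′_1,…,α′_m ∈ F_q` and admissible arrays `𝙲′_1,…,𝙲′_m`, each a composition of
`(Σ₁ ⊔ Σ₂, w₁ + w₂)`, all independent of `d`, such that for all `d ∈ ℕ`:
`S_{<d}(𝙰)·S_{<d}(𝙱) = Σ_i α′_i S_{<d}(𝙲′_i)`, where `S_{<d} = Σ_{k<d} S_k`,
in the polynomial ring over `K = F_q(θ)` in the indeterminates `t_n`.
-/

open Polynomial Finset

noncomputable section

variable (Fq : Type) [Field Fq] [Fintype Fq]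

/-- The monic polynomial `θ^d + Σ_{i<d} c_i θ^i`; as `c` ranges over `Fin d → Fq`
these are exactly the elements of `A^+(d)`. -/
def mP (d : ℕ) (c : Fin d → Fq) : Polynomial Fq :=
  Polynomial.X ^ d + ∑ i : Fin d, Polynomial.C (c i) * Polynomial.X ^ (i : ℕ)

/-- `a` as an element of `K`. -/
def aK (a : Polynomial Fq) : RatFunc Fq := algebraMap (Polynomial Fq) (RatFunc Fq) a

/-- The canonical map `F_q → K`. -/
def FqK : Fq →+* RatFunc Fq :=
  (algebraMap (Polynomial Fq) (RatFunc Fq)).comp Polynomial.C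

/-- `a(t_n)`: substitute `θ` by the indeterminate `t_n` in `a ∈ A`. -/
def tval (n : ℕ+) (a : Polynomial Fq) : MvPolynomial ℕ+ (RatFunc Fq) :=
  Polynomial.eval₂ ((MvPolynomial.C : RatFunc Fq →+* MvPolynomial ℕ+ (RatFunc Fq)).comp (FqK Fq))
    (MvPolynomial.X n) a

/-- The character `χ_Σ(a) = ∏_n a(t_n)^{σ_n}` of a finite weighted subset. -/
def chiW (Sg : ℕ+ →₀ ℕ) (a : Polynomial Fq) : MvPolynomial ℕ+ (RatFunc Fq) :=
  Sg.prod fun n e => (tval Fq n a) ^ e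

/-- The depth-one power sum `S_d(Σ; s) = Σ_{a ∈ A^+(d)} χ_Σ(a)/a^s`. -/
def S1 (d : ℕ) (Sg : ℕ+ →₀ ℕ) (s : ℕ) : MvPolynomial ℕ+ (RatFunc Fq) :=
  ∑ c : Fin d → Fq, chiW Fq Sg (mP Fq d c) * MvPolynomial.C ((aK Fq (mP Fq d c)) ^ s)⁻¹

/-- Power sums of arrays, encoded as lists of pairs `(Σ_i, s_i)`:
`S_d(𝙰) = Σ_{d = d_1 > … > d_r ≥ 0} ∏_i S_{d_i}(Σ_i; s_i)`. -/
def SP : List ((ℕ+ →₀ ℕ) × ℕ) → ℕ → MvPolynomial ℕ+ (RatFunc Fq)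
  | [], d => if d = 0 then 1 else 0
  | [x], d => S1 Fq d x.1 x.2
  | x :: y :: L, d => S1 Fq d x.1 x.2 * ∑ k ∈ Finset.range d, SP (y :: L) k

/-- `𝙰` is an admissible array which is a composition of `(Σ, w)`: all exponents
are positive, the types add up (pointwise) to `Σ` and the exponents add up to `w`. -/
def IsCompW (L : List ((ℕ+ →₀ ℕ) × ℕ)) (Sg : ℕ+ →₀ ℕ) (w : ℕ) : Prop :=
  (∀ x ∈ L, 1 ≤ x.2) ∧ (L.map Prod.fst).sum = Sg ∧ (L.map Prod.snd).sum = w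

set_option linter.unusedSectionVars false

/-- `S_{<d}(𝙰)`, with the convention that it is `1` for the empty array. -/
def partialSum (L : List ((ℕ+ →₀ ℕ) × ℕ)) (d : ℕ) : MvPolynomial ℕ+ (RatFunc Fq) :=
  if L = [] then 1 else ∑ k ∈ Finset.range d, SP Fq L k

/-- The `F_q`-span of the functions `d ↦ S_{<d}(𝙰)`, for `𝙰` a composition of `(Σ, w)`. -/
def arraySpan (Sg : ℕ+ →₀ ℕ) (w : ℕ) : Submodule Fq (ℕ → MvPolynomial ℕ+ (RatFunc Fq)) :=
  Submodule.span Fq {f | ∃ L, IsCompW L Sg w ∧ partialSum Fq L = f}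

/-- The `F_q`-span of the functions `d ↦ S_d(𝙰)`, for `𝙰` a composition of `(Σ, w)` of
depth two. -/
def depthTwoSpan (Sg : ℕ+ →₀ ℕ) (w : ℕ) : Submodule Fq (ℕ → MvPolynomial ℕ+ (RatFunc Fq)) :=
  Submodule.span Fq {f | ∃ (G H : ℕ+ →₀ ℕ) (s t : ℕ), 1 ≤ s ∧ 1 ≤ t ∧ G + H = Sg ∧ s + t = w ∧
    (fun d => S1 Fq d G s * partialSum Fq [(H, t)] d) = f}

/-- The summation operator `f ↦ (d ↦ ∑_{k < d} f k)`. -/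
def sumBelow : (ℕ → MvPolynomial ℕ+ (RatFunc Fq)) →ₗ[Fq] (ℕ → MvPolynomial ℕ+ (RatFunc Fq)) where
  toFun f d := ∑ k ∈ Finset.range d, f k
  map_add' f g := by
    ext1 d
    simp [Finset.sum_add_distrib]
  map_smul' c f := by
    ext1 d
    simp [Finset.smul_sum]

/-- The polynomial `Σ_{i<d} c_i θ^i`. -/
def lowP (d : ℕ) (c : Fin d → Fq) : Polynomial Fq :=
  ∑ i : Fin d, Polynomial.C (c i) * Polynomial.X ^ (i : ℕ)

/-- `1/a^s` as a constant polynomial in the `t_n`. -/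
def invPow (a : Polynomial Fq) (s : ℕ) : MvPolynomial ℕ+ (RatFunc Fq) :=
  MvPolynomial.C ((aK Fq a) ^ s)⁻¹

/-- The sum of `χ_Σ(a) χ_Γ(b) / (a^s b^t (a-b)^m)` over monic `a, b` of degree `d`; for `m ≥ 1`
the terms with `a = b` vanish. -/
def pairSum (Sg Gm : ℕ+ →₀ ℕ) (s t m d : ℕ) : MvPolynomial ℕ+ (RatFunc Fq) :=
  ∑ c : Fin d → Fq, ∑ c' : Fin d → Fq,
    chiW Fq Sg (mP Fq d c) * chiW Fq Gm (mP Fq d c') *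
      (invPow Fq (mP Fq d c) s * invPow Fq (mP Fq d c') t *
        invPow Fq (mP Fq d c - mP Fq d c') m)

/-- The sum of `χ_Σ(a) g(a, n) / (a^s n^m)` over monic `a` of degree `d` and monic `n` of degree
less than `d`, as a linear function of `g`. -/
def weightedPairSum (Sg : ℕ+ →₀ ℕ) (s m : ℕ) :
    (Polynomial Fq × Polynomial Fq → MvPolynomial ℕ+ (RatFunc Fq)) →ₗ[Fq]
      (ℕ → MvPolynomial ℕ+ (RatFunc Fq)) where
  toFun g d := ∑ c : Fin d → Fq, ∑ j ∈ Finset.range d, ∑ e : Fin j → Fq,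
    chiW Fq Sg (mP Fq d c) * g (mP Fq d c, mP Fq j e) *
      (invPow Fq (mP Fq d c) s * invPow Fq (mP Fq j e) m)
  map_add' f g := by
    ext1 d
    simp only [Pi.add_apply, mul_add, add_mul, Finset.sum_add_distrib]
  map_smul' c f := by
    ext1 d
    simp only [Pi.smul_apply, mul_smul_comm, smul_mul_assoc, Finset.smul_sum, RingHom.id_apply]

theorem smul_eq_C_FqK_mul (c : Fq) (x : MvPolynomial ℕ+ (RatFunc Fq)) :
    c • x = MvPolynomial.C (FqK Fq c) * x := by
  rw [Algebra.smul_def]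
  rfl

theorem invPow_add (a : Polynomial Fq) (s t : ℕ) :
    invPow Fq a (s + t) = invPow Fq a s * invPow Fq a t := by
  simp only [invPow, pow_add, mul_inv, map_mul]

theorem invPow_zero_left {m : ℕ} (hm : 1 ≤ m) : invPow Fq 0 m = 0 := by
  have : m ≠ 0 := by omega
  simp [invPow, aK, this]

theorem invPow_zero_right (a : Polynomial Fq) : invPow Fq a 0 = 1 := by
  simp [invPow]

theorem invPow_neg (a : Polynomial Fq) (m : ℕ) :
    invPow Fq (-a) m = (-1 : Fq) ^ m • invPow Fq a m := by
  rw [smul_eq_C_FqK_mul, invPow, invPow, ← map_mul, aK, aK, map_neg, neg_pow, mul_inv]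
  congr 2
  rcases Nat.even_or_odd m with h | h <;> simp [h.neg_one_pow]

theorem invPow_C_mul (l : Fq) (a : Polynomial Fq) (m : ℕ) :
    invPow Fq (Polynomial.C l * a) m = (l⁻¹ ^ m) • invPow Fq a m := by
  rw [smul_eq_C_FqK_mul, invPow, invPow, ← map_mul, aK, aK, map_mul, mul_pow, mul_inv,
    map_pow, map_inv₀, inv_pow]
  rfl

theorem invPow_succ_mul_invPow_succ {a b : Polynomial Fq} (ha : a ≠ 0) (hb : b ≠ 0)
    (hab : a ≠ b) (s t m : ℕ) :
    invPow Fq a (s + 1) * invPow Fq b (t + 1) * invPow Fq (a - b) m =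
      invPow Fq a s * invPow Fq b (t + 1) * invPow Fq (a - b) (m + 1) -
        invPow Fq a (s + 1) * invPow Fq b t * invPow Fq (a - b) (m + 1) := by
  have inj := IsFractionRing.injective (Polynomial Fq) (RatFunc Fq)
  have ha' : aK Fq a ≠ 0 := fun h => ha (inj (h.trans (map_zero _).symm))
  have hb' : aK Fq b ≠ 0 := fun h => hb (inj (h.trans (map_zero _).symm))
  have hab' : aK Fq a - aK Fq b ≠ 0 := fun h => hab (inj (sub_eq_zero.1 h))
  have hsub : aK Fq (a - b) = aK Fq a - aK Fq b := map_sub _ _ _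
  simp only [invPow, hsub, ← map_mul, ← map_sub]
  congr 1
  field_simp
  ring

theorem chiW_add (G H : ℕ+ →₀ ℕ) (a : Polynomial Fq) :
    chiW Fq (G + H) a = chiW Fq G a * chiW Fq H a :=
  Finsupp.prod_add_index' (by simp) fun _ _ _ => pow_add _ _ _

theorem tval_sub_C_mul (n : ℕ+) (l : Fq) (a b : Polynomial Fq) :
    tval Fq n (a - Polynomial.C l * b) = tval Fq n a - l • tval Fq n b := by
  simp [tval, smul_eq_C_FqK_mul, Polynomial.eval₂_sub, Polynomial.eval₂_mul]

theorem mP_eq (d : ℕ) (c : Fin d → Fq) : mP Fq d c = Polynomial.X ^ d + lowP Fq d c := rfl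

theorem lowP_sub (d : ℕ) (c c' : Fin d → Fq) :
    lowP Fq d (c - c') = lowP Fq d c - lowP Fq d c' := by
  simp [lowP, sub_mul, Finset.sum_sub_distrib]

theorem lowP_smul (d : ℕ) (l : Fq) (c : Fin d → Fq) :
    lowP Fq d (l • c) = Polynomial.C l * lowP Fq d c := by
  simp [lowP, Finset.mul_sum, mul_assoc]

theorem mP_sub (d : ℕ) (c f : Fin d → Fq) : mP Fq d (c - f) = mP Fq d c - lowP Fq d f := by
  rw [mP_eq, mP_eq, lowP_sub]
  ring

theorem lowP_snoc (d : ℕ) (c : Fin d → Fq) (l : Fq) :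
    lowP Fq (d + 1) (Fin.snoc c l) = lowP Fq d c + Polynomial.C l * Polynomial.X ^ d := by
  simp [lowP, Fin.sum_univ_castSucc]

theorem coeff_lowP (d : ℕ) (c : Fin d → Fq) (i : Fin d) : (lowP Fq d c).coeff i = c i := by
  simp [lowP, Polynomial.coeff_X_pow, Fin.val_inj]

theorem mP_injective (d : ℕ) : Function.Injective (mP Fq d) := by
  intro c c' h
  ext i
  rw [mP_eq, mP_eq, add_right_inj] at h
  rw [← coeff_lowP Fq d c, h, coeff_lowP]

theorem mP_ne_zero (d : ℕ) (c : Fin d → Fq) : mP Fq d c ≠ 0 := by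
  intro h
  have hc : (mP Fq d c).coeff d = 1 := by
    simp only [mP, Polynomial.coeff_add, Polynomial.coeff_X_pow, Polynomial.finsetSum_coeff,
      Polynomial.coeff_C_mul, if_true, add_eq_left]
    refine Finset.sum_eq_zero fun i _ => ?_
    rw [if_neg (by have := i.2; omega), mul_zero]
  simp [h] at hc

/-- The binomial expansion of `χ_Σ(a - λ b)`. -/
theorem chiW_sub_C_mul_mem_span (l : Fq) (Sg : ℕ+ →₀ ℕ) :
    (fun x : Polynomial Fq × Polynomial Fq => chiW Fq Sg (x.1 - Polynomial.C l * x.2)) ∈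
      Submodule.span Fq {g | ∃ G H : ℕ+ →₀ ℕ, G + H = Sg ∧
        (fun x : Polynomial Fq × Polynomial Fq => chiW Fq G x.1 * chiW Fq H x.2) = g} := by
  have hadd : ∀ (S T : ℕ+ →₀ ℕ)
      (f g : Polynomial Fq × Polynomial Fq → MvPolynomial ℕ+ (RatFunc Fq)),
      f ∈ Submodule.span Fq {g | ∃ G H : ℕ+ →₀ ℕ, G + H = S ∧
        (fun x : Polynomial Fq × Polynomial Fq => chiW Fq G x.1 * chiW Fq H x.2) = g} →
      g ∈ Submodule.span Fq {g | ∃ G H : ℕ+ →₀ ℕ, G + H = T ∧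
        (fun x : Polynomial Fq × Polynomial Fq => chiW Fq G x.1 * chiW Fq H x.2) = g} →
      f * g ∈ Submodule.span Fq {g | ∃ G H : ℕ+ →₀ ℕ, G + H = S + T ∧
        (fun x : Polynomial Fq × Polynomial Fq => chiW Fq G x.1 * chiW Fq H x.2) = g} := by
    intro S T f g hf hg
    have h := Submodule.mul_mem_mul hf hg
    rw [Submodule.span_mul_span] at h
    refine Submodule.span_mono ?_ h
    rintro _ ⟨_, ⟨G, H, rfl, rfl⟩, _, ⟨G', H', rfl, rfl⟩, rfl⟩
    refine ⟨G + G', H + H', add_add_add_comm _ _ _ _, ?_⟩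
    ext1 x
    simp only [chiW_add, Pi.mul_apply]
    ring
  have hzero : (fun x : Polynomial Fq × Polynomial Fq =>
      chiW Fq 0 (x.1 - Polynomial.C l * x.2)) ∈
      Submodule.span Fq {g | ∃ G H : ℕ+ →₀ ℕ, G + H = 0 ∧
        (fun x : Polynomial Fq × Polynomial Fq => chiW Fq G x.1 * chiW Fq H x.2) = g} :=
    Submodule.subset_span ⟨0, 0, add_zero 0, by simp [chiW]⟩
  induction Sg using Finsupp.induction_linear with
  | zero => exact hzero
  | add S T hS hT =>
    simp only [chiW_add]
    exact hadd S T _ _ hS hT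
  | single n e =>
    induction e with
    | zero =>
      rw [Finsupp.single_zero]
      exact hzero
    | succ e ih =>
      simp only [Finsupp.single_add, chiW_add]
      refine hadd _ _ _ _ ih ?_
      have hone : ∀ a, chiW Fq (Finsupp.single n 1) a = tval Fq n a := by simp [chiW]
      have h0 : ∀ a, chiW Fq 0 a = 1 := by simp [chiW]
      simp only [hone, tval_sub_C_mul]
      refine Submodule.sub_mem _ (Submodule.subset_span ?_)
        (Submodule.smul_mem _ l (Submodule.subset_span ?_))
      · exact ⟨Finsupp.single n 1, 0, add_zero _, by simp [hone, h0]⟩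
      · exact ⟨0, Finsupp.single n 1, zero_add _, by simp [hone, h0]⟩

/-- A nonzero polynomial of degree less than `d` is uniquely a nonzero constant times a monic
polynomial of degree less than `d`. -/
theorem sum_lowP [DecidableEq Fq] {M : Type*} [AddCommMonoid M] (G : Polynomial Fq → M) (d : ℕ) :
    ∑ f : Fin d → Fq, G (lowP Fq d f) =
      G 0 + ∑ l ∈ Finset.univ.erase (0 : Fq), ∑ j ∈ Finset.range d, ∑ e : Fin j → Fq,
        G (Polynomial.C l * mP Fq j e) := by
  induction d with
  | zero => simp [lowP]
  | succ d ih =>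
    have hsplit : ∑ f : Fin (d + 1) → Fq, G (lowP Fq (d + 1) f) =
        ∑ l : Fq, ∑ f : Fin d → Fq, G (lowP Fq d f + Polynomial.C l * Polynomial.X ^ d) := by
      rw [← (Fin.snocEquiv fun _ : Fin (d + 1) => Fq).sum_comp, Fintype.sum_prod_type]
      exact Finset.sum_congr rfl fun l _ => Finset.sum_congr rfl fun f _ =>
        congrArg G (lowP_snoc Fq d f l)
    have hunit : ∀ l ∈ Finset.univ.erase (0 : Fq),
        ∑ f : Fin d → Fq, G (lowP Fq d f + Polynomial.C l * Polynomial.X ^ d) =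
          ∑ e : Fin d → Fq, G (Polynomial.C l * mP Fq d e) := by
      intro l hl
      have hbij : Function.Bijective fun e : Fin d → Fq => l • e :=
        MulAction.bijective (Units.mk0 l (Finset.ne_of_mem_erase hl))
      rw [← hbij.sum_comp]
      refine Finset.sum_congr rfl fun e _ => ?_
      rw [lowP_smul, mP_eq, mul_add, add_comm]
    rw [hsplit, ← Finset.add_sum_erase _ _ (Finset.mem_univ (0 : Fq)), Finset.sum_congr rfl hunit]
    simp only [map_zero, zero_mul, add_zero, ih, Finset.sum_range_succ, Finset.sum_add_distrib,
      add_assoc]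

theorem SP_cons (x : (ℕ+ →₀ ℕ) × ℕ) (L : List ((ℕ+ →₀ ℕ) × ℕ)) (d : ℕ) :
    SP Fq (x :: L) d = S1 Fq d x.1 x.2 * partialSum Fq L d := by
  cases L <;> simp [SP, partialSum]

theorem partialSum_of_ne_nil {L : List ((ℕ+ →₀ ℕ) × ℕ)} (hL : L ≠ []) (d : ℕ) :
    partialSum Fq L d = ∑ k ∈ Finset.range d, SP Fq L k :=
  if_neg hL

theorem partialSum_cons (x : (ℕ+ →₀ ℕ) × ℕ) (L : List ((ℕ+ →₀ ℕ) × ℕ)) :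
    partialSum Fq (x :: L) =
      sumBelow Fq ((fun k => S1 Fq k x.1 x.2) * partialSum Fq L) := by
  ext1 d
  simp only [partialSum_of_ne_nil Fq (List.cons_ne_nil x L), SP_cons]
  rfl

theorem partialSum_nil : partialSum Fq [] = 1 := by
  ext1 d
  simp [partialSum]

theorem partialSum_singleton (G : ℕ+ →₀ ℕ) (s d : ℕ) :
    partialSum Fq [(G, s)] d = ∑ k ∈ Finset.range d, S1 Fq k G s := by
  rw [partialSum_of_ne_nil Fq (by simp)]
  rfl

/-- Product of two sums, split according to which index is larger. -/
theorem sumBelow_mul_sumBelow (f g : ℕ → MvPolynomial ℕ+ (RatFunc Fq)) :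
    sumBelow Fq f * sumBelow Fq g =
      sumBelow Fq (f * sumBelow Fq g) + sumBelow Fq (g * sumBelow Fq f) + sumBelow Fq (f * g) := by
  ext1 d
  simp only [sumBelow, LinearMap.coe_mk, AddHom.coe_mk, Pi.mul_apply, Pi.add_apply]
  induction d with
  | zero => simp
  | succ d ih =>
    simp only [Finset.sum_range_succ] at ih ⊢
    linear_combination ih

theorem isCompW_cons {L : List ((ℕ+ →₀ ℕ) × ℕ)} {G Sg : ℕ+ →₀ ℕ} {s w : ℕ} (hs : 1 ≤ s)
    (hL : IsCompW L Sg w) : IsCompW ((G, s) :: L) (G + Sg) (s + w) := by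
  obtain ⟨h1, rfl, rfl⟩ := hL
  exact ⟨by simpa [hs] using h1, by simp, by simp⟩

theorem exists_isCompW_of_cons {L : List ((ℕ+ →₀ ℕ) × ℕ)} {G Sg : ℕ+ →₀ ℕ} {s w : ℕ}
    (h : IsCompW ((G, s) :: L) Sg w) :
    1 ≤ s ∧ ∃ (Gm : ℕ+ →₀ ℕ) (v : ℕ), IsCompW L Gm v ∧ G + Gm = Sg ∧ s + v = w := by
  obtain ⟨h1, h2, h3⟩ := h
  rw [List.forall_mem_cons] at h1
  exact ⟨h1.1, _, _, ⟨h1.2, rfl, rfl⟩, by simpa using h2, by simpa using h3⟩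

theorem sumBelow_S1_mul_mem {Sg : ℕ+ →₀ ℕ} {w : ℕ} {f : ℕ → MvPolynomial ℕ+ (RatFunc Fq)}
    (hf : f ∈ arraySpan Fq Sg w) (G : ℕ+ →₀ ℕ) {s : ℕ} (hs : 1 ≤ s) :
    sumBelow Fq ((fun k => S1 Fq k G s) * f) ∈ arraySpan Fq (G + Sg) (s + w) := by
  induction hf using Submodule.span_induction with
  | mem f h =>
    obtain ⟨L, hL, rfl⟩ := h
    exact Submodule.subset_span ⟨(G, s) :: L, isCompW_cons hs hL, partialSum_cons Fq _ L⟩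
  | zero => simp
  | add f g _ _ hf hg =>
    rw [mul_add, map_add]
    exact Submodule.add_mem _ hf hg
  | smul c f _ hf =>
    rw [mul_smul_comm, map_smul]
    exact Submodule.smul_mem _ c hf

theorem pairSum_swap (Sg Gm : ℕ+ →₀ ℕ) (s t m : ℕ) :
    pairSum Fq Sg Gm s t m = (-1 : Fq) ^ m • pairSum Fq Gm Sg t s m := by
  ext1 d
  rw [Pi.smul_apply, pairSum, pairSum, Finset.sum_comm]
  simp only [Finset.smul_sum]
  refine Finset.sum_congr rfl fun c _ => Finset.sum_congr rfl fun c' _ => ?_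
  rw [← neg_sub (mP Fq d c) (mP Fq d c'), invPow_neg, mul_smul_comm, mul_smul_comm]
  congr 1
  ring

theorem weightedPairSum_mem (Sg Gm : ℕ+ →₀ ℕ) {s m : ℕ} (hs : 1 ≤ s) (hm : 1 ≤ m)
    {g : Polynomial Fq × Polynomial Fq → MvPolynomial ℕ+ (RatFunc Fq)}
    (hg : g ∈ Submodule.span Fq {g | ∃ G H : ℕ+ →₀ ℕ, G + H = Gm ∧
      (fun x : Polynomial Fq × Polynomial Fq => chiW Fq G x.1 * chiW Fq H x.2) = g}) :
    weightedPairSum Fq Sg s m g ∈ depthTwoSpan Fq (Sg + Gm) (s + m) := by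
  rw [← Submodule.mem_comap]
  refine Submodule.span_le.2 ?_ hg
  rintro _ ⟨G, H, rfl, rfl⟩
  refine Submodule.subset_span ⟨Sg + G, H, s, m, hs, hm, add_assoc _ _ _, rfl, ?_⟩
  ext1 d
  rw [partialSum_singleton]
  simp only [weightedPairSum, LinearMap.coe_mk, AddHom.coe_mk, S1, chiW_add]
  rw [Finset.sum_mul]
  simp only [Finset.mul_sum]
  refine Finset.sum_congr rfl fun c _ => Finset.sum_congr rfl fun j _ =>
    Finset.sum_congr rfl fun e _ => ?_
  simp only [invPow]
  ring

theorem pairSum_zero_mem (Sg Gm : ℕ+ →₀ ℕ) {s m : ℕ} (hs : 1 ≤ s) (hm : 1 ≤ m) :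
    pairSum Fq Sg Gm s 0 m ∈ depthTwoSpan Fq (Sg + Gm) (s + m) := by
  classical
  have hsum : pairSum Fq Sg Gm s 0 m = ∑ l ∈ Finset.univ.erase (0 : Fq), (l⁻¹ ^ m) •
      weightedPairSum Fq Sg s m (fun x => chiW Fq Gm (x.1 - Polynomial.C l * x.2)) := by
    ext1 d
    simp only [Finset.sum_apply, Pi.smul_apply, weightedPairSum, LinearMap.coe_mk, AddHom.coe_mk,
      Finset.smul_sum]
    rw [Finset.sum_comm, pairSum]
    refine Finset.sum_congr rfl fun c _ => ?_
    rw [← (Equiv.subLeft c).sum_comp]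
    simp only [Equiv.subLeft_apply, mP_sub, sub_sub_cancel, invPow_zero_right, mul_one]
    rw [sum_lowP Fq (fun p => chiW Fq Sg (mP Fq d c) * chiW Fq Gm (mP Fq d c - p) *
      (invPow Fq (mP Fq d c) s * invPow Fq p m)), invPow_zero_left Fq hm, mul_zero, mul_zero,
      zero_add]
    simp only [invPow_C_mul, mul_smul_comm]
  rw [hsum]
  exact Submodule.sum_mem _ fun l _ =>
    Submodule.smul_mem _ _ (weightedPairSum_mem Fq Sg Gm hs hm (chiW_sub_C_mul_mem_span Fq l Gm))

theorem pairSum_mem (Sg Gm : ℕ+ →₀ ℕ) (s t m : ℕ) (hst : 1 ≤ s + t) (hm : 1 ≤ m) :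
    pairSum Fq Sg Gm s t m ∈ depthTwoSpan Fq (Sg + Gm) (s + t + m) := by
  induction hn : s + t using Nat.strong_induction_on generalizing s t m with
  | _ n ih =>
  subst hn
  rcases t with _ | t
  · exact pairSum_zero_mem Fq Sg Gm hst hm
  rcases s with _ | s
  · rw [pairSum_swap, add_comm Sg, add_comm 0]
    exact Submodule.smul_mem _ _ (pairSum_zero_mem Fq Gm Sg (by omega) hm)
  have hrec : pairSum Fq Sg Gm (s + 1) (t + 1) m =
      pairSum Fq Sg Gm s (t + 1) (m + 1) - pairSum Fq Sg Gm (s + 1) t (m + 1) := by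
    ext1 d
    simp only [pairSum, Pi.sub_apply, ← Finset.sum_sub_distrib, ← mul_sub]
    refine Finset.sum_congr rfl fun c _ => Finset.sum_congr rfl fun c' _ => ?_
    congr 1
    by_cases h : mP Fq d c = mP Fq d c'
    · rw [h, sub_self, invPow_zero_left Fq hm, invPow_zero_left Fq (by omega)]
      ring
    · exact invPow_succ_mul_invPow_succ Fq (mP_ne_zero Fq d c) (mP_ne_zero Fq d c') h s t m
  rw [hrec]
  have h1 := ih _ (by omega) s (t + 1) (m + 1) (by omega) (by omega) rfl
  have h2 := ih _ (by omega) (s + 1) t (m + 1) (by omega) (by omega) rfl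
  rw [show s + (t + 1) + (m + 1) = s + 1 + (t + 1) + m by ring] at h1
  rw [show s + 1 + t + (m + 1) = s + 1 + (t + 1) + m by ring] at h2
  exact Submodule.sub_mem _ h1 h2

/-- The product of two power sums of depth one. -/
theorem S1_mul_S1 (Sg Gm : ℕ+ →₀ ℕ) {s t : ℕ} (hs : 1 ≤ s) (ht : 1 ≤ t) :
    ∃ h ∈ depthTwoSpan Fq (Sg + Gm) (s + t),
      ((fun k => S1 Fq k Sg s) * fun k => S1 Fq k Gm t) =
        (fun k => S1 Fq k (Sg + Gm) (s + t)) + h := by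
  classical
  obtain ⟨s, rfl⟩ := Nat.exists_eq_add_of_le' hs
  obtain ⟨t, rfl⟩ := Nat.exists_eq_add_of_le' ht
  refine ⟨pairSum Fq Sg Gm s (t + 1) 1 - pairSum Fq Sg Gm (s + 1) t 1, ?_, ?_⟩
  · have h1 := pairSum_mem Fq Sg Gm s (t + 1) 1 (by omega) le_rfl
    have h2 := pairSum_mem Fq Sg Gm (s + 1) t 1 (by omega) le_rfl
    rw [show s + (t + 1) + 1 = s + 1 + (t + 1) by ring] at h1
    exact Submodule.sub_mem _ h1 h2
  · ext1 d
    have hdiag : S1 Fq d (Sg + Gm) (s + 1 + (t + 1)) =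
        ∑ c : Fin d → Fq, ∑ c' : Fin d → Fq, if c = c' then
          chiW Fq (Sg + Gm) (mP Fq d c) * invPow Fq (mP Fq d c) (s + 1 + (t + 1)) else 0 := by
      simp only [Finset.sum_ite_eq, Finset.mem_univ, if_true]
      rfl
    simp only [Pi.mul_apply, Pi.add_apply, Pi.sub_apply, hdiag]
    simp only [S1, pairSum, Finset.sum_mul_sum, ← Finset.sum_sub_distrib,
      ← Finset.sum_add_distrib]
    refine Finset.sum_congr rfl fun c _ => Finset.sum_congr rfl fun c' _ => ?_
    change chiW Fq Sg (mP Fq d c) * invPow Fq (mP Fq d c) (s + 1) *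
      (chiW Fq Gm (mP Fq d c') * invPow Fq (mP Fq d c') (t + 1)) = _
    split_ifs with h
    · subst h
      rw [sub_self, invPow_zero_left Fq le_rfl, chiW_add,
        invPow_add Fq _ (s + 1) (t + 1)]
      ring
    · have := invPow_succ_mul_invPow_succ Fq (mP_ne_zero Fq d c) (mP_ne_zero Fq d c')
        (fun h' => h (mP_injective Fq d h')) s t 0
      rw [invPow_zero_right, mul_one, zero_add] at this
      linear_combination chiW Fq Sg (mP Fq d c) * chiW Fq Gm (mP Fq d c') * this

theorem sumBelow_depthTwo_mul_mem {Sg Gm : ℕ+ →₀ ℕ} {v w : ℕ}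
    {h g : ℕ → MvPolynomial ℕ+ (RatFunc Fq)}
    (hh : h ∈ depthTwoSpan Fq Sg v) (hg : g ∈ arraySpan Fq Gm w)
    (ih : ∀ (A B : List ((ℕ+ →₀ ℕ) × ℕ)) (S T : ℕ+ →₀ ℕ) (a b : ℕ), IsCompW A S a →
      IsCompW B T b → a + b < v + w →
        partialSum Fq A * partialSum Fq B ∈ arraySpan Fq (S + T) (a + b)) :
    sumBelow Fq (h * g) ∈ arraySpan Fq (Sg + Gm) (v + w) := by
  induction hh using Submodule.span_induction with
  | mem h hh =>
    obtain ⟨G, H, s, t, hs, ht, rfl, rfl, rfl⟩ := hh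
    induction hg using Submodule.span_induction with
    | mem g hg =>
      obtain ⟨L, hL, rfl⟩ := hg
      have hH : IsCompW [(H, t)] H t := ⟨by simpa using ht, by simp, by simp⟩
      have := sumBelow_S1_mul_mem Fq (ih _ L H Gm t w hH hL (by omega)) G hs
      rw [← mul_assoc, ← add_assoc, ← add_assoc] at this
      exact this
    | zero => simp
    | add f g _ _ hf hg =>
      rw [mul_add, map_add]
      exact Submodule.add_mem _ hf hg
    | smul c f _ hf =>
      rw [mul_smul_comm, map_smul]
      exact Submodule.smul_mem _ c hf
  | zero => simp
  | add f g _ _ hf hg =>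
    rw [add_mul, map_add]
    exact Submodule.add_mem _ hf hg
  | smul c f _ hf =>
    rw [smul_mul_assoc, map_smul]
    exact Submodule.smul_mem _ c hf

theorem partialSum_mul_mem_arraySpan (A B : List ((ℕ+ →₀ ℕ) × ℕ)) (Sg Gm : ℕ+ →₀ ℕ) (v w : ℕ)
    (hA : IsCompW A Sg v) (hB : IsCompW B Gm w) :
    partialSum Fq A * partialSum Fq B ∈ arraySpan Fq (Sg + Gm) (v + w) := by
  induction hn : v + w using Nat.strong_induction_on generalizing A B Sg Gm v w with
  | _ n ih =>
  subst hn
  rcases A with _ | ⟨⟨G, s⟩, A⟩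
  · obtain ⟨-, rfl, rfl⟩ := hA
    rw [partialSum_nil, one_mul]
    exact Submodule.subset_span ⟨B, by simpa using hB, rfl⟩
  rcases B with _ | ⟨⟨H, t⟩, B⟩
  · obtain ⟨-, rfl, rfl⟩ := hB
    rw [partialSum_nil, mul_one]
    exact Submodule.subset_span ⟨_, by simpa using hA, rfl⟩
  obtain ⟨hs, S, a, hA', rfl, rfl⟩ := exists_isCompW_of_cons hA
  obtain ⟨ht, T, b, hB', rfl, rfl⟩ := exists_isCompW_of_cons hB
  have h1 := sumBelow_S1_mul_mem Fq (ih _ (by omega) A _ S _ a _ hA' hB rfl) G hs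
  have h2 := sumBelow_S1_mul_mem Fq (ih _ (by omega) _ B _ T _ b hA hB' rfl) H ht
  have h3 := ih _ (by omega) A B S T a b hA' hB' rfl
  obtain ⟨h, hh, hprod⟩ := S1_mul_S1 Fq G H hs ht
  have h4 := sumBelow_S1_mul_mem Fq h3 (G + H) (s := s + t) (by omega)
  have h5 := sumBelow_depthTwo_mul_mem Fq hh h3 fun A' B' S' T' a' b' hA'' hB'' hlt =>
    ih _ (by omega) A' B' S' T' a' b' hA'' hB'' rfl
  rw [show G + (S + (H + T)) = G + S + (H + T) by abel,
    show s + (a + (t + b)) = s + a + (t + b) by ring] at h1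
  rw [show H + (G + S + T) = G + S + (H + T) by abel,
    show t + (s + a + b) = s + a + (t + b) by ring] at h2
  rw [show G + H + (S + T) = G + S + (H + T) by abel,
    show s + t + (a + b) = s + a + (t + b) by ring] at h4 h5
  have h45 := Submodule.add_mem _ h4 h5
  rw [← map_add, ← add_mul, ← hprod] at h45
  have key := Submodule.add_mem _ (Submodule.add_mem _ h1 h2) h45
  rw [partialSum_cons Fq (G, s) A, partialSum_cons Fq (H, t) B] at key ⊢
  rwa [sumBelow_mul_sumBelow, mul_assoc, mul_assoc _ (partialSum Fq B), mul_mul_mul_comm,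
    mul_comm (partialSum Fq B)]

theorem statement6 (Sg1 Sg2 : ℕ+ →₀ ℕ) (w1 w2 : ℕ) (hw1 : 1 ≤ w1) (hw2 : 1 ≤ w2)
    (A B : List ((ℕ+ →₀ ℕ) × ℕ)) (hA : IsCompW A Sg1 w1) (hB : IsCompW B Sg2 w2) :
    ∃ (m : ℕ) (α : Fin m → Fq) (Cs : Fin m → List ((ℕ+ →₀ ℕ) × ℕ)),
      (∀ i, IsCompW (Cs i) (Sg1 + Sg2) (w1 + w2)) ∧
      ∀ d : ℕ, (∑ k ∈ Finset.range d, SP Fq A k) * (∑ k ∈ Finset.range d, SP Fq B k) =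
        ∑ i, MvPolynomial.C (FqK Fq (α i)) * ∑ k ∈ Finset.range d, SP Fq (Cs i) k := by
  have hne : ∀ (L : List ((ℕ+ →₀ ℕ) × ℕ)) (Sg : ℕ+ →₀ ℕ) (w : ℕ), 1 ≤ w → IsCompW L Sg w →
      L ≠ [] := by
    rintro L Sg w hw ⟨-, -, h⟩ rfl
    simp at h
    omega
  obtain ⟨m, α, g, hg⟩ := Submodule.mem_span_set'.1
    (partialSum_mul_mem_arraySpan Fq A B Sg1 Sg2 w1 w2 hA hB)
  choose Cs hCs hCs' using fun i => (g i).2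
  refine ⟨m, α, Cs, hCs, fun d => ?_⟩
  have h := congrFun hg d
  simp only [Finset.sum_apply, Pi.smul_apply, Pi.mul_apply, smul_eq_C_FqK_mul,
    partialSum_of_ne_nil Fq (hne A _ _ hw1 hA), partialSum_of_ne_nil Fq (hne B _ _ hw2 hB)] at h
  rw [← h]
  refine Finset.sum_congr rfl fun i _ => ?_
  rw [← hCs', partialSum_of_ne_nil Fq (hne _ _ _ (by omega) (hCs i))]

end
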